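/- Let A be a bireversible automaton over a two-letter alphabet X = {x, y} (x ≠ y), and let n ≥ 1 be an integer such that in π₁(Δ_A) the elements s(y⁻¹x)ⁿs⁻¹, s(y⁻¹x)⁻ⁿs⁻¹, s⁻¹(y⁻¹x)ⁿs and s⁻¹(y⁻¹x)⁻ⁿs all belong to ⟨X⟩ for every s ∈ S. Then there exists a group endomorphism φ of π₁(Δ_A) with φ(s) = s for all s ∈ S, φ(x) = x(y⁻¹x)ⁿ and φ(y) = y(x⁻¹y)ⁿ, and the fixed subgroup of φ equals ⟨S⟩: {γ ∈ π₁(Δ_A) | φ(γ) = γ} = ⟨S⟩. -/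

import Mathlib

/-- A Mealy automaton with state set `S` and alphabet `X`:
`λ(s,x) = (o s x, t s x)`. -/
structure Mealy (S X : Type) where
  o : S → X → X
  t : S → X → S

namespace Mealy

variable {S X : Type}

/-- Bireversibility of a Mealy automaton. -/
def Bireversible (M : Mealy S X) : Prop :=
  (∀ s, Function.Bijective (M.o s)) ∧
  (∀ x, Function.Bijective (fun s => M.t s x)) ∧
  Function.Bijective (fun p : S × X => (M.o p.1 p.2, M.t p.1 p.2))

/-- The action of a state on words over the alphabet. -/
def actWord (M : Mealy S X) : S → List X → List X
  | _, [] => []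
  | s, x :: w => M.o s x :: M.actWord (M.t s x) w

/-- The dual action of a letter on words over the states. -/
def dualActWord (M : Mealy S X) : X → List S → List S
  | _, [] => []
  | x, s :: w => M.t s x :: M.dualActWord (M.o s x) w

/-- The relators `s x (t s x)⁻¹ (o s x)⁻¹` of the square-complex group. -/
def rels (M : Mealy S X) : Set (FreeGroup (S ⊕ X)) :=
  ⋃ (s : S) (x : X),
    {FreeGroup.of (Sum.inl s) * FreeGroup.of (Sum.inr x) *
      (FreeGroup.of (Sum.inl (M.t s x)))⁻¹ * (FreeGroup.of (Sum.inr (M.o s x)))⁻¹}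

/-- The fundamental group `π₁(Δ_A)` of the square complex of the automaton. -/
abbrev Pi1 (M : Mealy S X) := PresentedGroup M.rels

/-- The image of a state in `π₁(Δ_A)`. -/
def genS (M : Mealy S X) (s : S) : M.Pi1 := PresentedGroup.of (Sum.inl s)

/-- The image of a letter in `π₁(Δ_A)`. -/
def genX (M : Mealy S X) (x : X) : M.Pi1 := PresentedGroup.of (Sum.inr x)

/-- The subgroup `⟨S⟩` of `π₁(Δ_A)`. -/
def subS (M : Mealy S X) : Subgroup M.Pi1 := Subgroup.closure (Set.range M.genS)

/-- The subgroup `⟨X⟩` of `π₁(Δ_A)`. -/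
def subX (M : Mealy S X) : Subgroup M.Pi1 := Subgroup.closure (Set.range M.genX)

/-- The automaton group `G_A`: the subgroup of `Perm (List X)` generated by the
permutations `σ_s` defined by the states. -/
def autGroup (M : Mealy S X) : Subgroup (Equiv.Perm (List X)) :=
  Subgroup.closure {σ : Equiv.Perm (List X) | ∃ s, ⇑σ = M.actWord s}

/-- The dual automaton group `G_{∂A}`. -/
def dualAutGroup (M : Mealy S X) : Subgroup (Equiv.Perm (List S)) :=
  Subgroup.closure {τ : Equiv.Perm (List S) | ∃ x, ⇑τ = M.dualActWord x}

end Mealy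

namespace Mealy

variable {S X : Type}

section WordAction

variable (o : S → X → X) (T : X → Equiv.Perm S)

/-- Reading the letter `x` in state `p.2`, after having written the group element `p.1`. -/
def stepPerm (x : X) : Equiv.Perm (FreeGroup X × S) where
  toFun p := (p.1 * FreeGroup.of (o p.2 x), T x p.2)
  invFun p := (p.1 * (FreeGroup.of (o ((T x).symm p.2) x))⁻¹, (T x).symm p.2)
  left_inv p := by simp
  right_inv p := by simp

/-- Reading an element of the free group on the alphabet. -/
def readPerm (w : FreeGroup X) : Equiv.Perm (FreeGroup X × S) :=
  (FreeGroup.lift (fun x => (stepPerm o T x)⁻¹) w)⁻¹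

/-- The element of the free group written by the state `s` while reading `w`. -/
def output (s : S) (w : FreeGroup X) : FreeGroup X := (readPerm o T w (1, s)).1

/-- The state reached from `s` after reading `w`. -/
def nextState (s : S) (w : FreeGroup X) : S := (readPerm o T w (1, s)).2

theorem readPerm_one : readPerm o T 1 = 1 := by simp [readPerm]

theorem readPerm_mul (v w : FreeGroup X) (p : FreeGroup X × S) :
    readPerm o T (v * w) p = readPerm o T w (readPerm o T v p) := by
  simp [readPerm]

theorem readPerm_of (x : X) : readPerm o T (FreeGroup.of x) = stepPerm o T x := by
  simp [readPerm]

theorem readPerm_inv (w : FreeGroup X) : readPerm o T w⁻¹ = (readPerm o T w).symm := by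
  simp only [readPerm, map_inv]; rfl

theorem readPerm_left_mul (w : FreeGroup X) :
    ∀ (v u : FreeGroup X) (s : S), readPerm o T w (v * u, s) =
      (v * (readPerm o T w (u, s)).1, (readPerm o T w (u, s)).2) := by
  induction w using FreeGroup.induction_on with
  | C1 => intro v u s; simp [readPerm_one]
  | of x => intro v u s; simp [readPerm_of, stepPerm, mul_assoc]
  | inv_of x _ => intro v u s; simp [readPerm_inv, readPerm_of, stepPerm, mul_assoc]
  | mul a b ha hb => intro v u s; rw [readPerm_mul, ha, hb, ← readPerm_mul]

theorem readPerm_eq (v w : FreeGroup X) (s : S) :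
    readPerm o T w (v, s) = (v * output o T s w, nextState o T s w) := by
  simpa [output, nextState] using readPerm_left_mul o T w v 1 s

theorem output_one (s : S) : output o T s 1 = 1 := by simp [output, readPerm_one]

theorem nextState_one (s : S) : nextState o T s 1 = s := by simp [nextState, readPerm_one]

theorem output_of (s : S) (x : X) :
    output o T s (FreeGroup.of x) = FreeGroup.of (o s x) := by
  simp [output, readPerm_of, stepPerm]

theorem nextState_of (s : S) (x : X) : nextState o T s (FreeGroup.of x) = T x s := by
  simp [nextState, readPerm_of, stepPerm]

theorem output_mul (s : S) (v w : FreeGroup X) :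
    output o T s (v * w) = output o T s v * output o T (nextState o T s v) w := by
  rw [output, readPerm_mul, readPerm_eq o T 1 v, readPerm_eq, one_mul]

theorem nextState_mul (s : S) (v w : FreeGroup X) :
    nextState o T s (v * w) = nextState o T (nextState o T s v) w := by
  rw [nextState, readPerm_mul, readPerm_eq o T 1 v, readPerm_eq]

theorem nextState_nextState_inv (s : S) (w : FreeGroup X) :
    nextState o T (nextState o T s w⁻¹) w = s := by
  rw [← nextState_mul, inv_mul_cancel, nextState_one]

theorem output_inv (s : S) (w : FreeGroup X) :
    output o T (nextState o T s w) w⁻¹ = (output o T s w)⁻¹ := by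
  rw [eq_inv_iff_mul_eq_one, ← mul_eq_one_comm, ← output_mul, mul_inv_cancel, output_one]

theorem nextState_inv (s : S) (w : FreeGroup X) :
    nextState o T (nextState o T s w) w⁻¹ = s := by
  rw [← nextState_mul, mul_inv_cancel, nextState_one]

theorem output_leftInverse {o o' : S → X → X} {T T' : X → Equiv.Perm S}
    (ho : ∀ s x, o' s (o s x) = x) (hT : ∀ s x, T' (o s x) s = T x s) (w : FreeGroup X) :
    ∀ s, output o' T' s (output o T s w) = w ∧
      nextState o' T' s (output o T s w) = nextState o T s w := by
  induction w using FreeGroup.induction_on with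
  | C1 => intro s; simp [output_one, nextState_one]
  | of x => intro s; simp [output_of, nextState_of, ho, hT]
  | inv_of x hx =>
    intro s
    obtain ⟨r, rfl⟩ : ∃ r, nextState o T r (FreeGroup.of x) = s :=
      ⟨_, nextState_nextState_inv o T s _⟩
    obtain ⟨h1, h2⟩ := hx r
    rw [output_inv, nextState_inv]
    rw [← h2]
    rw [output_inv, nextState_inv, h1]
    exact ⟨rfl, rfl⟩
  | mul a b ha hb =>
    intro s
    obtain ⟨h1, h2⟩ := ha s
    obtain ⟨h3, h4⟩ := hb (nextState o T s a)
    rw [output_mul, output_mul, nextState_mul, nextState_mul, h1, h2, h3, h4]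
    exact ⟨rfl, rfl⟩

end WordAction

section Group

variable (M : Mealy S X)

theorem genS_mul_genX (s : S) (x : X) :
    M.genS s * M.genX x = M.genX (M.o s x) * M.genS (M.t s x) := by
  have h := PresentedGroup.one_of_mem (rels := M.rels)
    (Set.mem_iUnion₂.2 ⟨s, x, Set.mem_singleton _⟩)
  simp only [map_mul, map_inv] at h
  rwa [mul_inv_eq_one, mul_inv_eq_iff_eq_mul] at h

/-- Homomorphisms out of `π₁(Δ_A)` from images of the generators. -/
theorem exists_hom {G : Type*} [Group G] (f : S → G) (g : X → G)
    (h : ∀ s x, f s * g x = g (M.o s x) * f (M.t s x)) :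
    ∃ φ : M.Pi1 →* G, (∀ s, φ (M.genS s) = f s) ∧ ∀ x, φ (M.genX x) = g x := by
  refine ⟨PresentedGroup.toGroup (f := Sum.elim f g) ?_, fun s => ?_, fun x => ?_⟩
  · intro r hr
    obtain ⟨s, x, rfl⟩ := Set.mem_iUnion₂.1 hr
    simp [h s x]
  · exact PresentedGroup.toGroup.of _
  · exact PresentedGroup.toGroup.of _

/-- The canonical map from the free group on the alphabet to `π₁(Δ_A)`. -/
def ofWord : FreeGroup X →* M.Pi1 := FreeGroup.lift M.genX

theorem ofWord_of (x : X) : M.ofWord (FreeGroup.of x) = M.genX x := by simp [ofWord]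

theorem exists_ofWord_eq {g : M.Pi1} (hg : g ∈ M.subX) : ∃ w, M.ofWord w = g := by
  rwa [subX, ← FreeGroup.range_lift_eq_closure] at hg

variable {M}

theorem exists_action (hb : M.Bireversible) :
    ∃ ρ : M.Pi1 →* Equiv.Perm (FreeGroup X), (∀ s, ρ (M.genS s) 1 = 1) ∧
      ∀ x, ρ (M.genX x) = Equiv.mulLeft (FreeGroup.of x) := by
  obtain ⟨h1, h2, h3⟩ := hb
  let O (s : S) : Equiv.Perm X := Equiv.ofBijective _ (h1 s)
  have hO (s : S) (x : X) : M.o s ((O s).symm x) = x := (O s).apply_symm_apply x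
  have hO' (s : S) (x : X) : (O s).symm (M.o s x) = x := (O s).symm_apply_apply x
  have h4 (z : X) : Function.Bijective (fun s => M.t s ((O s).symm z)) := by
    constructor
    · intro a b hab
      have := @h3.1 (a, (O a).symm z) (b, (O b).symm z) (by simpa [hO] using hab)
      exact congrArg Prod.fst this
    · intro s
      obtain ⟨⟨r, x⟩, hr⟩ := h3.2 (z, s)
      simp only [Prod.mk.injEq] at hr
      refine ⟨r, ?_⟩
      rw [← hr.1, ← hr.2]
      simp only [hO']
  let T (x : X) : Equiv.Perm S := Equiv.ofBijective _ (h2 x)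
  let T' (x : X) : Equiv.Perm S := Equiv.ofBijective _ (h4 x)
  let o' (s : S) (x : X) : X := (O s).symm x
  let σ (s : S) : Equiv.Perm (FreeGroup X) :=
    { toFun := output M.o T s
      invFun := output o' T' s
      left_inv := fun w => (output_leftInverse (T := T) (T' := T') hO'
        (fun s x => by simp [T, T', hO']) w s).1
      right_inv := fun w => (output_leftInverse (o := o') (T := T') (T' := T) hO
        (fun s x => by simp [T, T', o']) w s).1 }
  obtain ⟨ρ, hS, hX⟩ := M.exists_hom σ (fun x => Equiv.mulLeft (FreeGroup.of x)) (by
    intro s x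
    ext1 w
    simp [σ, output_mul, output_of, nextState_of, T])
  exact ⟨ρ, fun s => by rw [hS]; exact output_one M.o T s, hX⟩

theorem eq_one_of_ofWord_mem_subS (hb : M.Bireversible) {w : FreeGroup X}
    (hw : M.ofWord w ∈ M.subS) : w = 1 := by
  obtain ⟨ρ, hS, hX⟩ := exists_action hb
  have hle : M.subS ≤ (MulAction.stabilizer (Equiv.Perm (FreeGroup X)) (1 : FreeGroup X)).comap ρ :=
    (Subgroup.closure_le _).2 (by rintro _ ⟨s, rfl⟩; exact hS s)
  have h1 : ρ (M.ofWord w) 1 = 1 := hle hw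
  have h2 (v : FreeGroup X) : ρ (M.ofWord v) = MulAction.toPermHom _ _ v := by
    rw [← MonoidHom.comp_apply]
    congr 1
    ext1 x
    rw [MonoidHom.comp_apply, ofWord_of, hX]
    rfl
  simpa [h2] using h1

theorem ofWord_injective (hb : M.Bireversible) : Function.Injective M.ofWord :=
  (injective_iff_map_eq_one _).2 fun _ hw =>
    eq_one_of_ofWord_mem_subS hb (hw ▸ M.subS.one_mem)

theorem genS_mem_subS (s : S) : M.genS s ∈ M.subS := Subgroup.subset_closure ⟨s, rfl⟩

theorem exists_swap (hb : M.Bireversible) (w : FreeGroup X) : ∀ s,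
    (∃ v r, M.genS s * M.ofWord w = M.ofWord v * M.genS r) ∧
    ∃ v r, (M.genS s)⁻¹ * M.ofWord w = M.ofWord v * (M.genS r)⁻¹ := by
  obtain ⟨h1, h2, h3⟩ := hb
  induction w using FreeGroup.induction_on with
  | C1 => exact fun s => ⟨⟨1, s, by simp⟩, 1, s, by simp⟩
  | of x =>
    intro s
    refine ⟨⟨FreeGroup.of (M.o s x), M.t s x, ?_⟩, ?_⟩
    · simp only [ofWord_of, genS_mul_genX]
    · obtain ⟨z, rfl⟩ := (h1 s).2 x
      refine ⟨FreeGroup.of z, M.t s z, ?_⟩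
      rw [ofWord_of, ofWord_of, inv_mul_eq_iff_eq_mul, ← mul_assoc, eq_mul_inv_iff_mul_eq,
        genS_mul_genX]
  | inv_of x _ =>
    intro s
    constructor
    · obtain ⟨r, rfl⟩ := (h2 x).2 s
      refine ⟨(FreeGroup.of (M.o r x))⁻¹, r, ?_⟩
      rw [map_inv, map_inv, ofWord_of, ofWord_of, eq_inv_mul_iff_mul_eq, ← mul_assoc,
        ← genS_mul_genX, mul_inv_cancel_right]
    · obtain ⟨⟨r, z⟩, hr⟩ := h3.2 (x, s)
      simp only [Prod.mk.injEq] at hr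
      obtain ⟨rfl, rfl⟩ := hr
      refine ⟨(FreeGroup.of z)⁻¹, r, ?_⟩
      rw [map_inv, map_inv, ofWord_of, ofWord_of, ← mul_inv_rev, ← mul_inv_rev, genS_mul_genX]
  | mul a b ha hb =>
    intro s
    constructor
    · obtain ⟨v, r, h⟩ := (ha s).1
      obtain ⟨v', r', h'⟩ := (hb r).1
      refine ⟨v * v', r', ?_⟩
      rw [map_mul, map_mul, ← mul_assoc, h, mul_assoc, h', mul_assoc]
    · obtain ⟨v, r, h⟩ := (ha s).2
      obtain ⟨v', r', h'⟩ := (hb r).2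
      refine ⟨v * v', r', ?_⟩
      rw [map_mul, map_mul, ← mul_assoc, h, mul_assoc, h', mul_assoc]

theorem exists_eq_ofWord_mul (hb : M.Bireversible) (γ : M.Pi1) :
    ∃ w, ∃ u ∈ M.subS, γ = M.ofWord w * u := by
  suffices h : ∀ v, ∃ w, ∃ u ∈ M.subS, γ * M.ofWord v = M.ofWord w * u by
    simpa using h 1
  induction γ using PresentedGroup.induction_on with | _ g
  induction g using FreeGroup.induction_on with
  | C1 => exact fun v => ⟨v, 1, one_mem _, by simp⟩
  | of a =>
    intro v
    rcases a with s | x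
    · obtain ⟨w, r, h⟩ := (exists_swap hb v s).1
      exact ⟨w, _, genS_mem_subS r, h⟩
    · exact ⟨FreeGroup.of x * v, 1, one_mem _, by rw [map_mul, ofWord_of, mul_one]; rfl⟩
  | inv_of a _ =>
    intro v
    rcases a with s | x
    · obtain ⟨w, r, h⟩ := (exists_swap hb v s).2
      exact ⟨w, _, inv_mem (genS_mem_subS r), h⟩
    · refine ⟨(FreeGroup.of x)⁻¹ * v, 1, one_mem _, ?_⟩
      rw [map_mul, map_inv, map_inv, ofWord_of, mul_one]; rfl
  | mul a b ha hb' =>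
    intro v
    obtain ⟨w, u, hu, h⟩ := hb' v
    obtain ⟨w', u', hu', h'⟩ := ha w
    exact ⟨w', u' * u, mul_mem hu' hu, by rw [map_mul, mul_assoc, h, ← mul_assoc, h', mul_assoc]⟩

/-- Over a two-letter alphabet, a state moves past powers of `a⁻¹b` by writing powers of a single
quotient of letters. -/
theorem exists_genS_mul_pow (hb : M.Bireversible) {a b : X} (hab : a ≠ b)
    (hX : ∀ z : X, z = a ∨ z = b) (s : S) (k : ℕ) :
    ∃ r, M.genS (M.t s a) * ((M.genX a)⁻¹ * M.genX b) ^ k =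
      ((M.genX (M.o s a))⁻¹ * M.genX (M.o s b)) ^ k * M.genS (M.t r a) ∧
      M.o r a = M.o s a ∧ M.o r b = M.o s b := by
  obtain ⟨h1, h2, h3⟩ := hb
  have two {p q z : X} (hpq : p ≠ q) (hz : z ≠ q) : z = p := by
    rcases hX p with rfl | rfl <;> rcases hX q with rfl | rfl <;> rcases hX z with rfl | rfl <;>
      simp_all
  induction k with
  | zero => exact ⟨s, by simp, rfl, rfl⟩
  | succ k ih =>
    obtain ⟨r, h, ha, hb⟩ := ih
    obtain ⟨q, hq⟩ := (h2 a).2 (M.t r b)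
    simp only at hq
    have hne : M.o q a ≠ M.o r b := fun h =>
      hab (congrArg Prod.snd (@h3.1 (q, a) (r, b) (by simp [h, hq])))
    have hqa : M.o q a = M.o r a := two (fun h => hab ((h1 r).1 h)) hne
    have hqb : M.o q b = M.o r b :=
      two (fun h => hab ((h1 r).1 h).symm) (hqa ▸ fun h => hab ((h1 q).1 h).symm)
    refine ⟨q, ?_, hqa.trans ha, hqb.trans hb⟩
    have step : M.genS (M.t r a) * ((M.genX a)⁻¹ * M.genX b) =
        (M.genX (M.o r a))⁻¹ * M.genX (M.o r b) * M.genS (M.t q a) := by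
      rw [mul_assoc _ _ (M.genS _), hq, ← genS_mul_genX, eq_inv_mul_iff_mul_eq, ← mul_assoc,
        ← genS_mul_genX]
      group
    rw [pow_succ, ← mul_assoc, h, mul_assoc, step, pow_succ, ha, hb]
    simp only [mul_assoc]

theorem genS_mul_pow (hb : M.Bireversible) {a b : X} (hab : a ≠ b)
    (hX : ∀ z : X, z = a ∨ z = b) (s : S) (n : ℕ)
    (h : M.genS (M.t s a) * ((M.genX a)⁻¹ * M.genX b) ^ n * (M.genS (M.t s a))⁻¹ ∈ M.subX) :
    M.genS (M.t s a) * ((M.genX a)⁻¹ * M.genX b) ^ n =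
      ((M.genX (M.o s a))⁻¹ * M.genX (M.o s b)) ^ n * M.genS (M.t s a) := by
  obtain ⟨r, hr, -, -⟩ := exists_genS_mul_pow hb hab hX s n
  obtain ⟨w, hw⟩ := M.exists_ofWord_eq h
  set v : FreeGroup X := ((FreeGroup.of (M.o s a))⁻¹ * FreeGroup.of (M.o s b)) ^ n with hv
  have hv' : M.ofWord v = ((M.genX (M.o s a))⁻¹ * M.genX (M.o s b)) ^ n := by
    simp [hv, ofWord_of]
  rw [hr, ← hv', mul_assoc, ← inv_mul_eq_iff_eq_mul, ← map_inv, ← map_mul] at hw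
  have h1 := eq_one_of_ofWord_mem_subS hb
    (hw ▸ mul_mem (genS_mem_subS (M.t r a)) (inv_mem (genS_mem_subS (M.t s a))))
  rw [h1, map_one, eq_comm, mul_inv_eq_one] at hw
  rw [hr, hw]

end Group

end Mealy

namespace FreeGroup

variable {X : Type*} (e : X → X)

/-- The word `(z e(z)⁻¹)ᵏ z`, and its formal inverse for an inverted letter. -/
def alternatingWord : ℕ → X × Bool → List (X × Bool)
  | 0, a => [a]
  | k + 1, a => a :: (e a.1, !a.2) :: alternatingWord k a

theorem length_alternatingWord (k : ℕ) (a : X × Bool) :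
    (alternatingWord e k a).length = 2 * k + 1 := by
  induction k with
  | zero => rfl
  | succ k ih => simp [alternatingWord, ih]; ring

theorem head?_alternatingWord (k : ℕ) (a : X × Bool) :
    (alternatingWord e k a).head? = some a := by
  cases k <;> rfl

theorem getLast?_alternatingWord (k : ℕ) (a : X × Bool) :
    (alternatingWord e k a).getLast? = some a := by
  induction k with
  | zero => rfl
  | succ k ih => simp [alternatingWord, List.getLast?_cons, ih]

variable {e}

theorem isReduced_alternatingWord (he : ∀ z, e z ≠ z) (k : ℕ) (a : X × Bool) :
    IsReduced (alternatingWord e k a) := by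
  induction k with
  | zero => exact IsReduced.singleton
  | succ k ih =>
    refine isReduced_cons_cons.2 ⟨fun h => absurd h.symm (he _), List.isChain_cons.2 ⟨?_, ih⟩⟩
    rw [head?_alternatingWord]
    rintro _ ⟨⟩ h
    exact absurd h (he _)

theorem isReduced_flatMap_alternatingWord (he : ∀ z, e z ≠ z) (k : ℕ) {L : List (X × Bool)}
    (hL : IsReduced L) : IsReduced (L.flatMap (alternatingWord e k)) := by
  induction L with
  | nil => exact IsReduced.nil
  | cons a L ih =>
    obtain ⟨h1, h2⟩ := List.isChain_cons.1 hL
    refine List.isChain_append.2 ⟨isReduced_alternatingWord he k a, ih h2, ?_⟩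
    rw [getLast?_alternatingWord]
    rintro _ ⟨⟩
    cases L with
    | nil => simp
    | cons b L =>
      simpa [List.head?_append, head?_alternatingWord] using h1

variable (e) in
/-- The endomorphism `z ↦ z (e(z)⁻¹ z)ᵏ` of a free group. -/
def alternatingHom (k : ℕ) : FreeGroup X →* FreeGroup X :=
  lift fun z => of z * ((of (e z))⁻¹ * of z) ^ k

theorem mk_alternatingWord (k : ℕ) (a : X × Bool) :
    mk (alternatingWord e k a) = alternatingHom e k (mk [a]) := by
  have key (z : X) (k : ℕ) : of z * ((of (e z))⁻¹ * of z) ^ k =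
      (of z * (of (e z))⁻¹) ^ k * of z := by
    induction k with
    | zero => simp
    | succ k ih => rw [pow_succ, ← mul_assoc, ih, pow_succ]; group
  have cons (b : X × Bool) (L : List (X × Bool)) : mk (b :: L) = mk [b] * mk L := rfl
  have inv_of (z : X) : mk [(z, false)] = (of z)⁻¹ := rfl
  obtain ⟨z, b⟩ := a
  cases b
  · have h : alternatingHom e k (mk [(z, false)]) = (of z)⁻¹ * (of (e z) * (of z)⁻¹) ^ k := by
      rw [inv_of, _root_.map_inv, alternatingHom, lift_apply_of, key, mul_inv_rev, ← inv_pow]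
      group
    rw [h]
    clear h
    induction k with
    | zero => simp [alternatingWord, inv_of]
    | succ k ih =>
      rw [alternatingWord, cons, cons (e z, _), ih, inv_of, pow_succ']
      change _ * (of (e z) * _) = _
      group
  · rw [show mk [(z, true)] = of z from rfl, alternatingHom, lift_apply_of, key]
    induction k with
    | zero => simp [alternatingWord]; rfl
    | succ k ih =>
      rw [alternatingWord, cons, cons (e z, _), ih, pow_succ']
      change of z * ((of (e z))⁻¹ * _) = _
      group

theorem alternatingHom_mk (k : ℕ) (L : List (X × Bool)) :
    alternatingHom e k (mk L) = mk (L.flatMap (alternatingWord e k)) := by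
  induction L with
  | nil => exact _root_.map_one (alternatingHom e k)
  | cons a L ih =>
    rw [List.flatMap_cons, ← mul_mk, ← ih, mk_alternatingWord, ← _root_.map_mul]
    rfl

theorem eq_one_of_alternatingHom_eq_self (he : ∀ z, e z ≠ z) {k : ℕ} (hk : 1 ≤ k)
    {w : FreeGroup X} (hw : alternatingHom e k w = w) : w = 1 := by
  classical
  have h : w.toWord.flatMap (alternatingWord e k) = w.toWord := by
    rw [← (isReduced_flatMap_alternatingWord he k isReduced_toWord).reduce_eq, ← toWord_mk,
      ← alternatingHom_mk, mk_toWord, hw]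
  have hlen := congrArg List.length h
  simp only [List.length_flatMap, length_alternatingWord, List.map_const', List.sum_replicate,
    smul_eq_mul] at hlen
  rw [← toWord_eq_nil_iff, ← List.length_eq_zero_iff]
  nlinarith

end FreeGroup

open Mealy in
/-- For a bireversible automaton over the two-letter alphabet `X = {x, y}` and `n ≥ 1`
such that `s^{±1} (y⁻¹x)^{±n} s^{∓1} ∈ ⟨X⟩` for all states `s`, the assignment
`s ↦ s`, `x ↦ x(y⁻¹x)ⁿ`, `y ↦ y(x⁻¹y)ⁿ` extends to an endomorphism of `π₁(Δ_A)`
whose fixed subgroup is exactly `⟨S⟩`. -/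
theorem endomorphism_fixing_states {S X : Type} [Finite S] [Finite X]
    [Nonempty S] [Nonempty X] (M : Mealy S X) (hb : M.Bireversible)
    (x y : X) (hxy : x ≠ y) (hX2 : ∀ z : X, z = x ∨ z = y)
    (n : ℕ) (hn : 1 ≤ n)
    (h1 : ∀ s : S, M.genS s * ((M.genX y)⁻¹ * M.genX x) ^ (n : ℤ) * (M.genS s)⁻¹ ∈ M.subX)
    (h2 : ∀ s : S, M.genS s * ((M.genX y)⁻¹ * M.genX x) ^ (-(n : ℤ)) * (M.genS s)⁻¹ ∈ M.subX)
    (h3 : ∀ s : S, (M.genS s)⁻¹ * ((M.genX y)⁻¹ * M.genX x) ^ (n : ℤ) * M.genS s ∈ M.subX)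
    (h4 : ∀ s : S, (M.genS s)⁻¹ * ((M.genX y)⁻¹ * M.genX x) ^ (-(n : ℤ)) * M.genS s ∈ M.subX) :
    ∃ φ : M.Pi1 →* M.Pi1,
      (∀ s : S, φ (M.genS s) = M.genS s) ∧
      φ (M.genX x) = M.genX x * ((M.genX y)⁻¹ * M.genX x) ^ n ∧
      φ (M.genX y) = M.genX y * ((M.genX x)⁻¹ * M.genX y) ^ n ∧
      (∀ γ : M.Pi1, φ γ = γ ↔ γ ∈ M.subS) := by
  classical
  let e : X → X := fun z => Equiv.swap x y z
  have hex : e x = y := Equiv.swap_apply_left x y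
  have hey : e y = x := Equiv.swap_apply_right x y
  have he (z : X) : e z ≠ z := by
    rcases hX2 z with rfl | rfl
    · rw [hex]; exact hxy.symm
    · rw [hey]; exact hxy
  have hez (p q : X) (hpq : p ≠ q) : p = e q := by
    rcases hX2 p with rfl | rfl <;> rcases hX2 q with rfl | rfl <;> simp_all
  have hconj (s : S) (z : X) :
      M.genS s * ((M.genX z)⁻¹ * M.genX (e z)) ^ n * (M.genS s)⁻¹ ∈ M.subX := by
    rcases hX2 z with rfl | rfl
    · have h := h2 s
      rwa [zpow_neg, zpow_natCast, ← inv_pow, mul_inv_rev, inv_inv, ← hex] at h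
    · have h := h1 s
      rwa [zpow_natCast, ← hey] at h
  obtain ⟨φ, hS, hX⟩ := M.exists_hom M.genS
      (fun z => M.genX z * ((M.genX (e z))⁻¹ * M.genX z) ^ n) (by
    intro s z
    have hX' (u : X) : u = z ∨ u = e z := or_iff_not_imp_left.2 (hez u z)
    have h := genS_mul_pow hb (he z).symm hX' s n (hconj _ z)
    rw [hez (M.o s (e z)) (M.o s z) fun h => he z ((hb.1 s).1 h)] at h
    have hinv (u : X) : ((M.genX (e u))⁻¹ * M.genX u) ^ n =
        (((M.genX u)⁻¹ * M.genX (e u)) ^ n)⁻¹ := by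
      rw [← inv_pow, mul_inv_rev, inv_inv]
    rw [← mul_assoc, genS_mul_genX, mul_assoc, mul_assoc, hinv, hinv]
    congr 1
    rw [mul_inv_eq_iff_eq_mul, mul_assoc, h, inv_mul_cancel_left])
  have hfix (u : M.Pi1) (hu : u ∈ M.subS) : φ u = u := by
    have : M.subS ≤ MonoidHom.eqLocus φ (MonoidHom.id _) :=
      (Subgroup.closure_le _).2 (by rintro _ ⟨s, rfl⟩; exact hS s)
    exact this hu
  have hword (w : FreeGroup X) :
      φ (M.ofWord w) = M.ofWord (FreeGroup.alternatingHom e n w) := by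
    rw [← MonoidHom.comp_apply, ← MonoidHom.comp_apply]
    congr 1
    ext1 z
    simp [ofWord_of, hX, FreeGroup.alternatingHom]
  refine ⟨φ, hS, by rw [hX, hex], by rw [hX, hey], fun γ => ⟨fun hγ => ?_, hfix γ⟩⟩
  obtain ⟨w, u, hu, rfl⟩ := exists_eq_ofWord_mul hb γ
  rw [map_mul, hfix u hu, mul_left_inj, hword] at hγ
  rw [FreeGroup.eq_one_of_alternatingHom_eq_self he hn (ofWord_injective hb hγ)]
  simpa using hu
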